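/- Let a ∈ GF(Q)* with A_m(a) = 0, and let s = (q^m - 1)(p^d - 1)/((Q - 1)(q - 1)), which is a positive integer. Consider the set S = { G_1(y^s·λ·μ)^{q-1} : y ∈ G_2(GF(q^N)), λ ∈ GF(q)*, μ ∈ GF(Q)* }. Then: (1) S ⊆ GF(Q), S contains a nonzero element, and every nonzero x_0 ∈ S satisfies x_0^{q+1} + x_0 + a = 0; (2) for any nonzero x_0 ∈ S, x_0^2/a is a (q-1)-th power of an element of GF(Q); for any β ∈ GF(Q) with β^{q-1} = x_0^2/a, the equation w^q - w + 1/(β·x_0) = 0 has exactly p^d solutions w in GF(Q); and for any such solution w_0 ∈ GF(Q), the set of all zeros of P_a(X) in GF(Q) is {x_0} ∪ { (w_0 + α)^{q-1}·x_0 : α ∈ GF(p^d) }, which has exactly p^d + 1 elements. -/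

import Mathlib

open Polynomial

/-- The elements of a field of characteristic `p` fixed by the `n`-th power of Frobenius. -/
def frobeniusFixed (F : Type*) [Field F] (p : ℕ) [ExpChar F p] (n : ℕ) : Subfield F :=
  (iterateFrobenius F p n).eqLocusField (RingHom.id F)

theorem ncard_pow_eq_self {F : Type*} [Field F] {p : ℕ} [IsAlgClosed F] [Fact p.Prime]
    [CharP F p] {n : ℕ} (hn : n ≠ 0) :
    {x : F | x ^ p ^ n = x}.ncard = p ^ n := by
  classical
  have hp : 1 < p := (Fact.out : p.Prime).one_lt
  have h1 : 1 < p ^ n := Nat.one_lt_pow hn hp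
  have hsep : (X ^ p ^ n - X : F[X]).Separable := galois_poly_separable p _ (dvd_pow_self p hn)
  have hdeg := FiniteField.X_pow_card_sub_X_natDegree_eq F h1
  have hne := FiniteField.X_pow_card_sub_X_ne_zero F h1
  have hset : {x : F | x ^ p ^ n = x} = ((X ^ p ^ n - X : F[X]).roots.toFinset : Set F) := by
    ext x
    simp [hne, sub_eq_zero]
  rw [hset, Set.ncard_coe_finset, Multiset.toFinset_card_of_nodup (nodup_roots hsep),
    ← (IsAlgClosed.splits _).natDegree_eq_card_roots, hdeg]

section FrobeniusFixed

variable {F : Type*} [Field F] {p : ℕ} [ExpChar F p]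

theorem mem_frobeniusFixed {n : ℕ} {x : F} : x ∈ frobeniusFixed F p n ↔ x ^ p ^ n = x :=
  Iff.rfl

theorem mem_frobeniusFixed_iff_isPeriodicPt {n : ℕ} {x : F} :
    x ∈ frobeniusFixed F p n ↔ Function.IsPeriodicPt (frobenius F p) n x := by
  rw [mem_frobeniusFixed, Function.IsPeriodicPt, Function.IsFixedPt, iterate_frobenius]

theorem frobeniusFixed_mono {n n' : ℕ} (h : n ∣ n') :
    frobeniusFixed F p n ≤ frobeniusFixed F p n' := fun _ hx =>
  mem_frobeniusFixed_iff_isPeriodicPt.2 ((mem_frobeniusFixed_iff_isPeriodicPt.1 hx).trans_dvd h)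

theorem mem_frobeniusFixed_gcd {n k : ℕ} {x : F} (hn : x ∈ frobeniusFixed F p n)
    (hk : x ∈ frobeniusFixed F p k) : x ∈ frobeniusFixed F p (n.gcd k) :=
  mem_frobeniusFixed_iff_isPeriodicPt.2 ((mem_frobeniusFixed_iff_isPeriodicPt.1 hn).gcd
    (mem_frobeniusFixed_iff_isPeriodicPt.1 hk))

theorem dvd_of_frobeniusFixed_le [IsAlgClosed F] [Fact p.Prime] [CharP F p] {n j : ℕ}
    (hn : n ≠ 0) (h : frobeniusFixed F p n ≤ frobeniusFixed F p j) : n ∣ j := by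
  have hset : {x : F | x ^ p ^ n = x} = {x : F | x ^ p ^ n.gcd j = x} := by
    ext x
    exact ⟨fun hx => mem_frobeniusFixed_gcd hx (h hx),
      fun hx => frobeniusFixed_mono (Nat.gcd_dvd_left n j) hx⟩
  have hcard := ncard_pow_eq_self (F := F) (p := p) hn
  rw [hset, ncard_pow_eq_self (Nat.gcd_ne_zero_left hn)] at hcard
  rw [← Nat.pow_right_injective (Fact.out : p.Prime).two_le hcard]
  exact Nat.gcd_dvd_right n j

theorem iterate_iterateFrobenius (k i : ℕ) (x : F) :
    (iterateFrobenius F p k)^[i] x = x ^ (p ^ k) ^ i := by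
  induction i with
  | zero => simp
  | succ i ih => rw [Function.iterate_succ_apply', ih, iterateFrobenius_def, ← pow_mul, pow_succ]

/-- Independence of the powers of `x ↦ x ^ p ^ k` as characters of the fixed field. -/
theorem coeff_eq_zero_of_sum_pow_eq_zero [IsAlgClosed F] [Fact p.Prime] [CharP F p]
    {n k m : ℕ} (hn : n ≠ 0) (hdvd : ∀ j, 0 < j → j < m → ¬ n ∣ k * j) {c : ℕ → F}
    (hc : ∀ x ∈ frobeniusFixed F p n, ∑ i ∈ Finset.range m, c i * x ^ (p ^ k) ^ i = 0)
    {i : ℕ} (hi : i < m) : c i = 0 := by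
  let f : Fin m → (frobeniusFixed F p n →* F) := fun i =>
    (powMonoidHom ((p ^ k) ^ (i : ℕ))).comp (frobeniusFixed F p n).subtype.toMonoidHom
  have hlt : ∀ i j : Fin m, (i : ℕ) < j → f i ≠ f j := by
    intro i j hij hf
    refine hdvd (j - i) (by omega) (by omega) (dvd_of_frobeniusFixed_le (F := F) (p := p) hn ?_)
    intro x hx
    have hxf : x ^ (p ^ k) ^ (i : ℕ) = x ^ (p ^ k) ^ (j : ℕ) := DFunLike.congr_fun hf ⟨x, hx⟩
    rw [← Nat.sub_add_cancel hij.le, pow_add, pow_mul, ← pow_mul p k i, ← pow_mul p k] at hxf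
    exact (iterateFrobenius_inj F p (k * i) hxf).symm
  have hf : Function.Injective f := by
    intro i j hij
    by_contra hne
    rcases lt_or_gt_of_ne (Fin.val_ne_of_ne hne) with h | h
    · exact hlt i j h hij
    · exact hlt j i h hij.symm
  have hli := (linearIndependent_monoidHom (frobeniusFixed F p n) F).comp f hf
  rw [Fintype.linearIndependent_iff] at hli
  refine hli (fun i => c i) ?_ ⟨i, hi⟩
  ext x
  have := hc x x.2
  rw [Finset.sum_range] at this
  simpa [f] using this

end FrobeniusFixed

theorem modEq_one_of_mul_eq {e k m s : ℕ} (he : 2 ≤ e) (hk : k ≠ 0) (hm : m ≠ 0)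
    (hkm : Nat.Coprime m k)
    (hs : s * ((e ^ m - 1) * (e ^ k - 1)) = ((e ^ k) ^ m - 1) * (e - 1)) :
    s ≡ 1 [MOD e - 1] := by
  have hone : ∀ j, 1 ≤ e ^ j := fun j => Nat.one_le_pow _ _ (by omega)
  have hsZ : (s : ℤ) * (((e : ℤ) ^ m - 1) * ((e : ℤ) ^ k - 1)) =
      (((e : ℤ) ^ m) ^ k - 1) * ((e : ℤ) - 1) := by
    have h := congrArg (Nat.cast : ℕ → ℤ) hs
    rw [← pow_mul] at h
    push_cast [hone, (by omega : 1 ≤ e)] at h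
    rw [h, ← pow_mul, mul_comm k m]
  set T : ℤ := ∑ j ∈ Finset.range k, (e : ℤ) ^ j with hT
  set U : ℤ := ∑ i ∈ Finset.range k, ((e : ℤ) ^ m) ^ i with hU
  have hTe : T * ((e : ℤ) - 1) = (e : ℤ) ^ k - 1 := geom_sum_mul _ _
  have hUe : U * ((e : ℤ) ^ m - 1) = ((e : ℤ) ^ m) ^ k - 1 := geom_sum_mul _ _
  have he1 : (e : ℤ) - 1 ≠ 0 := by omega
  have hem : (e : ℤ) ^ m - 1 ≠ 0 := by
    have : (1 : ℤ) < (e : ℤ) ^ m := one_lt_pow₀ (by omega) hm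
    omega
  have hTpos : T ≠ 0 := by
    have : (1 : ℤ) < (e : ℤ) ^ k := one_lt_pow₀ (by omega) hk
    rintro h
    rw [h] at hTe
    omega
  have hsT : s * T = U := by
    rw [← hTe, ← hUe] at hsZ
    refine mul_right_cancel₀ (mul_ne_zero hem he1) ?_
    linear_combination hsZ
  have hmaps : Set.MapsTo (fun i => m * i % k) (Finset.range k) (Finset.range k) := fun i _ =>
    Finset.mem_coe.2 (Finset.mem_range.2 (Nat.mod_lt _ (Nat.pos_of_ne_zero hk)))
  have hinj : Set.InjOn (fun i => m * i % k) (Finset.range k) := by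
    intro i hi j hj hij
    have h : i ≡ j [MOD k] := Nat.ModEq.cancel_left_of_coprime hkm.symm hij
    exact h.eq_of_lt_of_lt (Finset.mem_range.1 hi) (Finset.mem_range.1 hj)
  have hTperm : ∑ i ∈ Finset.range k, (e : ℤ) ^ (m * i % k) = T :=
    Finset.sum_nbij (fun i => m * i % k) hmaps hinj
      (Finset.surjOn_of_injOn_of_card_le _ hmaps hinj le_rfl) (fun _ _ => rfl)
  have hdvd : (e : ℤ) ^ k - 1 ∣ U - T := by
    rw [← hTperm, hU, ← Finset.sum_sub_distrib]
    refine Finset.dvd_sum fun i _ => ?_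
    have h : (e : ℤ) ^ k - 1 ∣ ((e : ℤ) ^ k) ^ (m * i / k) - 1 := sub_one_dvd_pow_sub_one _ _
    have hdm : ((e : ℤ) ^ m) ^ i = (e : ℤ) ^ (m * i % k) * ((e : ℤ) ^ k) ^ (m * i / k) := by
      rw [← pow_mul, ← pow_mul, ← pow_add, Nat.mod_add_div]
    rw [hdm]
    exact (h.mul_left ((e : ℤ) ^ (m * i % k))).trans (dvd_of_eq (by ring))
  rw [← hTe, ← hsT] at hdvd
  have hdvd' : (e : ℤ) - 1 ∣ s - 1 := by
    refine (mul_dvd_mul_iff_left hTpos).1 (hdvd.trans (dvd_of_eq (by ring)))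
  refine (Nat.modEq_iff_dvd.2 ?_).symm
  push_cast [(by omega : 1 ≤ e)]
  exact hdvd'

section Twisted

variable {F : Type*} [Field F] {σ : F →+* F} {a : F} {b : ℕ → F}

theorem twisted_recurrence_right (hb0 : b 0 = 0) (hb1 : b 1 = 1)
    (hb : ∀ r, b (r + 2) = -σ (b (r + 1)) - σ a * σ (σ (b r))) (r : ℕ) :
    b (r + 2) = -b (r + 1) - σ^[r] a * b r := by
  induction r using Nat.twoStepInduction with
  | zero => simp [hb, hb0, hb1]
  | one => simp [hb, hb0, hb1]
  | more r ih1 ih2 =>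
    have h1 := congrArg (fun x => σ (σ x)) ih1
    have h2 := congrArg σ ih2
    have e2 : b (r + 2 + 1) = -σ (b (r + 2)) - σ a * σ (σ (b (r + 1))) := hb (r + 1)
    simp only [map_sub, map_neg, map_mul, Function.iterate_succ_apply'] at h1 h2 ⊢
    linear_combination hb (r + 2) - h2 - σ a * h1 + e2 + σ (σ (σ^[r] a)) * hb r

theorem iterate_eq_of_linearized_root (hb0 : b 0 = 0) (hb1 : b 1 = 1)
    (hb : ∀ r, b (r + 2) = -σ (b (r + 1)) - σ a * σ (σ (b r)))
    {z : F} (hz : σ (σ z) + σ z + a * z = 0) (r : ℕ) :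
    σ^[r + 1] z = b (r + 1) * σ z - a * σ (b r) * z := by
  induction r with
  | zero => simp [hb0, hb1]
  | succ r ih =>
    rw [Function.iterate_succ_apply', ih, hb]
    simp only [map_sub, map_mul]
    linear_combination σ (b (r + 1)) * hz

theorem linearized_root_of_sum (hb0 : b 0 = 0) (hb1 : b 1 = 1)
    (hb : ∀ r, b (r + 2) = -σ (b (r + 1)) - σ a * σ (σ (b r))) {M : ℕ}
    (ha : σ^[M + 2] a = a) (hbM : b (M + 2) = 0) {t : F}
    (ht : σ^[M + 2] t = -a * σ (b (M + 1)) * t) {z : F}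
    (hz : z = ∑ j ∈ Finset.range (M + 1), σ^[j + 1] (b (M + 1 - j)) * σ^[j] t) :
    σ (σ z) + σ z + a * z = 0 := by
  have h0 : a * z = a * σ (b (M + 1)) * t +
      ∑ j ∈ Finset.range (M + 1), a * σ^[j + 2] (b (M - j)) * σ^[j + 1] t := by
    rw [hz, Finset.sum_range_succ', Finset.sum_range_succ, mul_add, Finset.mul_sum]
    simp [hb0, mul_assoc, add_comm (a * _)]
  have h1 : σ z = ∑ j ∈ Finset.range (M + 1), σ^[j + 2] (b (M + 1 - j)) * σ^[j + 1] t := by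
    simp only [hz, map_sum, map_mul, ← Function.iterate_succ_apply' (f := σ)]
  have h2 : σ (σ z) = ∑ j ∈ Finset.range (M + 1), σ^[j + 2] (b (M + 2 - j)) * σ^[j + 1] t
      - a * σ (b (M + 1)) * t := by
    have hsucc : σ (σ z) =
        ∑ j ∈ Finset.range (M + 1), σ^[j + 1 + 2] (b (M + 2 - (j + 1))) * σ^[j + 1 + 1] t := by
      simp only [h1, map_sum, map_mul, ← Function.iterate_succ_apply' (f := σ)]
      refine Finset.sum_congr rfl fun j _ => ?_
      rw [show M + 2 - (j + 1) = M + 1 - j by omega]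
    have hs := Finset.sum_range_succ' (fun j => σ^[j + 2] (b (M + 2 - j)) * σ^[j + 1] t) (M + 1)
    rw [Finset.sum_range_succ, ← hsucc] at hs
    have hlast : M + 2 - (M + 1) = 1 := by omega
    simp only [hlast, hb1, Nat.sub_zero, hbM, iterate_map_one, iterate_map_zero, zero_mul,
      add_zero, one_mul] at hs
    rw [← hs, show M + 1 + 1 = M + 2 from rfl, ht]
    ring
  have hsum : ∑ j ∈ Finset.range (M + 1), σ^[j + 2] (b (M + 2 - j)) * σ^[j + 1] t +
      ∑ j ∈ Finset.range (M + 1), σ^[j + 2] (b (M + 1 - j)) * σ^[j + 1] t +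
      ∑ j ∈ Finset.range (M + 1), a * σ^[j + 2] (b (M - j)) * σ^[j + 1] t = 0 := by
    rw [← Finset.sum_add_distrib, ← Finset.sum_add_distrib]
    refine Finset.sum_eq_zero fun j hj => ?_
    obtain ⟨r, rfl⟩ := Nat.exists_eq_add_of_le (Finset.mem_range_succ_iff.1 hj)
    have e0 : j + r - j = r := by omega
    have e1 : j + r + 1 - j = r + 1 := by omega
    have e2 : j + r + 2 - j = r + 2 := by omega
    have hr : σ^[j + 2] (σ^[r] a) = a := by
      rw [← Function.iterate_add_apply, show j + 2 + r = j + r + 2 by ring, ha]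
    rw [e0, e1, e2, twisted_recurrence_right hb0 hb1 hb r]
    simp only [iterate_map_sub, iterate_map_neg, iterate_map_mul, hr]
    ring
  rw [h2, h1, h0]
  linear_combination hsum

theorem twisted_multiplier_fixed (hb0 : b 0 = 0) (hb1 : b 1 = 1)
    (hb : ∀ r, b (r + 2) = -σ (b (r + 1)) - σ a * σ (σ (b r))) {M : ℕ}
    (hbM : b (M + 1) = 0) :
    σ (-a * σ (b M)) = -a * σ (b M) := by
  have h1 : b (M + 2) = σ (-a * σ (b M)) := by
    rw [hb, hbM]
    simp
  have h2 : σ (b (M + 2)) = b (M + 2) := by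
    have e1 := hb (M + 1)
    have e2 := twisted_recurrence_right hb0 hb1 hb (M + 1)
    rw [hbM] at e1 e2
    simp only [map_zero, mul_zero, sub_zero] at e1 e2
    exact neg_injective (e1.symm.trans e2)
  rw [h1] at h2
  exact σ.injective h2

theorem twisted_multiplier_ne_zero (hb1 : b 1 = 1)
    (hb : ∀ r, b (r + 2) = -σ (b (r + 1)) - σ a * σ (σ (b r))) {M : ℕ}
    (ha : a ≠ 0) (hbM : b (M + 1) = 0) : -a * σ (b M) ≠ 0 := by
  have key : ∀ r, ¬ (b r = 0 ∧ b (r + 1) = 0) := by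
    intro r
    induction r with
    | zero => simp [hb1]
    | succ r ih =>
      rintro ⟨h1, h2⟩
      refine ih ⟨?_, h1⟩
      have h := hb r
      rw [h1, h2] at h
      simpa [ha] using h
  intro h
  have hM : b M = 0 := by simpa [ha] using h
  exact key M ⟨hM, hbM⟩

variable {K : Subfield F} {m : ℕ}

theorem iterate_eq_mul_of_mem (hK : ∀ x ∈ K, σ x ∈ K) {c x : F} (hc : c ∈ K)
    (hx : σ x = c * x) (i : ℕ) : ∃ e ∈ K, σ^[i] x = e * x := by
  induction i with
  | zero => exact ⟨1, K.one_mem, by simp⟩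
  | succ i ih =>
    obtain ⟨e, he, h⟩ := ih
    refine ⟨σ e * c, K.mul_mem (hK e he) hc, ?_⟩
    rw [Function.iterate_succ_apply', h, map_mul, hx, mul_assoc]

theorem iterate_mem (hK : ∀ x ∈ K, σ x ∈ K) (i : ℕ) {x : F} (hx : x ∈ K) : σ^[i] x ∈ K := by
  induction i with
  | zero => exact hx
  | succ i ih => rw [Function.iterate_succ_apply']; exact hK _ ih

theorem map_sum_iterate {x : F} (hx : σ^[m] x = x) :
    σ (∑ i ∈ Finset.range m, σ^[i] x) = ∑ i ∈ Finset.range m, σ^[i] x := by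
  have h := Finset.sum_range_succ_comm (fun i => σ^[i] x) m
  rw [Finset.sum_range_succ'] at h
  simp only [map_sum, ← Function.iterate_succ_apply' (f := σ)]
  rw [hx, Function.iterate_zero_apply, add_comm] at h
  exact add_left_cancel h

/-- A form of the multiplicative Hilbert theorem 90. -/
theorem exists_fixed_div_mem (hK : ∀ x ∈ K, σ x ∈ K) (hKm : ∀ x ∈ K, σ^[m] x = x) (hm : 0 < m)
    (hind : ∀ c : ℕ → F, (∀ x ∈ K, ∑ i ∈ Finset.range m, c i * σ^[i] x = 0) → ∀ i < m, c i = 0)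
    {c x : F} (hc : c ∈ K) (hx0 : x ≠ 0) (hx : σ x = c * x) (hxm : σ^[m] x = x) :
    ∃ u, u ≠ 0 ∧ σ u = u ∧ x / u ∈ K := by
  obtain ⟨θ, hθ, hu⟩ : ∃ θ ∈ K, ∑ i ∈ Finset.range m, σ^[i] x * σ^[i] θ ≠ 0 := by
    by_contra! h
    exact hx0 (by simpa using hind _ h 0 hm)
  refine ⟨_, hu, ?_, ?_⟩
  · simp only [← iterate_map_mul]
    exact map_sum_iterate (by rw [iterate_map_mul, hxm, hKm θ hθ])
  · rw [← inv_div, Finset.sum_div]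
    refine K.inv_mem (K.sum_mem fun i _ => ?_)
    obtain ⟨e, he, h⟩ := iterate_eq_mul_of_mem hK hc hx i
    rw [h, mul_right_comm, mul_div_cancel_right₀ _ hx0]
    exact K.mul_mem he (iterate_mem hK i hθ)

/-- A form of the additive Hilbert theorem 90. -/
theorem exists_fixed_sub_mem (hK : ∀ x ∈ K, σ x ∈ K) (hKm : ∀ x ∈ K, σ^[m] x = x) (hm : 0 < m)
    (hind : ∀ c : ℕ → F, (∀ x ∈ K, ∑ i ∈ Finset.range m, c i * σ^[i] x = 0) → ∀ i < m, c i = 0)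
    {w : F} (hw : σ w - w ∈ K) (hwm : σ^[m] w = w) :
    ∃ u, σ u = u ∧ w - u ∈ K := by
  obtain ⟨θ, hθ, hu⟩ : ∃ θ ∈ K, ∑ i ∈ Finset.range m, σ^[i] θ ≠ 0 := by
    by_contra! h
    exact one_ne_zero (hind (fun _ => (1 : F)) (by simpa using h) 0 hm)
  have hdiff : ∀ i, w - σ^[i] w ∈ K := by
    intro i
    induction i with
    | zero => simp
    | succ i ih =>
      rw [Function.iterate_succ_apply']
      have : w - σ (σ^[i] w) = σ (w - σ^[i] w) - (σ w - w) := by rw [map_sub]; ring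
      rw [this]
      exact K.sub_mem (hK _ ih) hw
  refine ⟨(∑ i ∈ Finset.range m, σ^[i] (w * θ)) / ∑ i ∈ Finset.range m, σ^[i] θ, ?_, ?_⟩
  · rw [map_div₀, map_sum_iterate (hKm θ hθ),
      map_sum_iterate (by rw [iterate_map_mul, hwm, hKm θ hθ])]
  · have : w - (∑ i ∈ Finset.range m, σ^[i] (w * θ)) / ∑ i ∈ Finset.range m, σ^[i] θ =
        (∑ i ∈ Finset.range m, (w - σ^[i] w) * σ^[i] θ) / ∑ i ∈ Finset.range m, σ^[i] θ := by
      rw [eq_div_iff hu, sub_mul, div_mul_cancel₀ _ hu]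
      simp only [sub_mul, iterate_map_mul, Finset.sum_sub_distrib, Finset.mul_sum]
    rw [this]
    exact K.div_mem (K.sum_mem fun i _ => K.mul_mem (hdiff i) (iterate_mem hK i hθ))
      (K.sum_mem fun i _ => iterate_mem hK i hθ)

/-- The parametrisation of the zeros `x` of `x * σ x + x + a` by a zero `x₀`. -/
theorem exists_affine_of_zero {x₀ x w β w₀ : F} (ha : a ≠ 0) (hx₀ : x₀ ≠ 0)
    (h₀ : x₀ * σ x₀ + x₀ + a = 0) (hx : x * σ x + x + a = 0)
    (hwx : w * x = σ w * x₀) (hβ0 : β ≠ 0) (hβ : σ β * a = x₀ ^ 2 * β)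
    (hw₀ : σ w₀ - w₀ + 1 / (β * x₀) = 0) :
    σ w = w ∨ ∃ γ α, γ ≠ 0 ∧ σ γ = γ ∧ σ α = α ∧ w = γ * (w₀ + α) := by
  have hσx₀ : σ x₀ ≠ 0 := (map_ne_zero σ).2 hx₀
  have hσβ : σ β ≠ 0 := (map_ne_zero σ).2 hβ0
  have hwx' := congrArg σ hwx
  simp only [map_mul] at hwx'
  have hv : x₀ * σ x₀ * (σ (σ w) - σ w) = a * (σ w - w) := by
    linear_combination w * hx - σ w * h₀ - (σ x + 1) * hwx - x₀ * hwx'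
  set γ := -(σ w - w) * (β * x₀) with hγdef
  have hγ : σ γ = γ := by
    simp only [hγdef, map_mul, map_neg, map_sub]
    refine mul_left_cancel₀ (mul_ne_zero ha hx₀) ?_
    linear_combination -(x₀ ^ 2 * β) * hv - (x₀ * σ x₀ * (σ (σ w) - σ w)) * hβ
  by_cases hγ0 : γ = 0
  · left
    have h : w - σ w = 0 := by simpa [hγdef, hβ0, hx₀] using hγ0
    exact (sub_eq_zero.1 h).symm
  · right
    refine ⟨γ, w / γ - w₀, hγ0, hγ, ?_, by field_simp; ring⟩
    rw [map_sub, map_div₀, hγ]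
    have h1 : (σ w - w) / γ = -(1 / (β * x₀)) := by
      have h2 : σ w - w ≠ 0 := by
        intro h
        simp [hγdef, h] at hγ0
      rw [hγdef]
      field_simp
    linear_combination h1 - hw₀

theorem iterate_eq_self_of_affine {x₀ z₀ w β B : F} (hx₀ : x₀ ≠ 0) (hz₀ : z₀ ≠ 0)
    (hz : σ z₀ = x₀ * z₀) (h₀ : x₀ * σ x₀ + x₀ + a = 0)
    (hB : ∀ z, σ (σ z) + σ z + a * z = 0 → σ^[m] z = B * z)
    (hβ0 : β ≠ 0) (hβ : σ β * a = x₀ ^ 2 * β) (hw : σ w - w + 1 / (β * x₀) = 0) :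
    σ^[m] w = w := by
  have hσx₀ : σ x₀ ≠ 0 := (map_ne_zero σ).2 hx₀
  have hσβ : σ β ≠ 0 := (map_ne_zero σ).2 hβ0
  have hσw : σ w = w - 1 / (β * x₀) := by linear_combination hw
  have hσσw : σ (σ w) = σ w - 1 / (σ β * σ x₀) := by
    conv_lhs => rw [hσw]
    simp
  have hdiff : x₀ * σ x₀ * (σ (σ w) - σ w) = a * (σ w - w) := by
    rw [hσσw, hσw]
    field_simp
    linear_combination hβ
  have h1 := hB z₀ (by rw [hz, map_mul, hz]; linear_combination z₀ * h₀)
  have h2 := hB (w * z₀) (by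
    simp only [map_mul, hz]
    linear_combination z₀ * hdiff + z₀ * σ w * h₀)
  rw [iterate_map_mul, h1] at h2
  have hB0 : B * z₀ ≠ 0 := by
    rw [← h1, ← RingHom.coe_pow]
    exact (_root_.map_ne_zero _).2 hz₀
  refine mul_right_cancel₀ hB0 ?_
  linear_combination h2

end Twisted

section Zeros

variable {F : Type*} [Field F] {p : ℕ} [Fact p.Prime] [CharP F p] {n k : ℕ}
  {a x₀ β w₀ : F}

theorem pow_ne_one_of_affine {q : ℕ} (hq : q ≠ 0) {w c : F} (hc : c ≠ 0)
    (hw : w ^ q - w + c = 0) : w ^ (q - 1) ≠ 1 := by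
  intro h
  rw [← pow_sub_one_mul hq w, h] at hw
  exact hc (by linear_combination hw)

theorem eq_div_of_affine {q : ℕ} (hq : q ≠ 0) {w c : F} (hc : c ≠ 0)
    (hw : w ^ q - w + c = 0) : w = -c / (w ^ (q - 1) - 1) := by
  rw [eq_div_iff (sub_ne_zero.2 (pow_ne_one_of_affine hq hc hw))]
  rw [← pow_sub_one_mul hq w] at hw
  linear_combination hw

theorem affine_add {w α c : F} (hw : w ^ p ^ k - w + c = 0) (hα : α ^ p ^ k = α) :
    (w + α) ^ p ^ k - (w + α) + c = 0 := by
  rw [add_pow_char_pow, hα]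
  linear_combination hw

theorem affine_solutions_eq {c w₁ : F} (hw₁n : w₁ ^ p ^ n = w₁)
    (hw₁ : w₁ ^ p ^ k - w₁ + c = 0) :
    {w : F | w ^ p ^ n = w ∧ w ^ p ^ k - w + c = 0} =
      (fun α => w₁ + α) '' {α : F | α ^ p ^ n.gcd k = α} := by
  ext w
  constructor
  · rintro ⟨hwn, hw⟩
    refine ⟨w - w₁, mem_frobeniusFixed_gcd (n := n) (k := k) (Subfield.sub_mem _ hwn hw₁n) ?_,
      add_sub_cancel _ _⟩
    rw [mem_frobeniusFixed, sub_pow_char_pow]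
    linear_combination hw - hw₁
  · rintro ⟨α, hα, rfl⟩
    exact ⟨Subfield.add_mem (frobeniusFixed F p n) hw₁n
      (frobeniusFixed_mono (Nat.gcd_dvd_left n k) hα),
      affine_add hw₁ (frobeniusFixed_mono (Nat.gcd_dvd_right n k) hα)⟩

theorem mul_pow_eq_of_pow_sub_one_eq {q : ℕ} (hq : q ≠ 0) (ha : a ≠ 0)
    (hβ : β ^ (q - 1) = x₀ ^ 2 / a) : β ^ q * a = x₀ ^ 2 * β := by
  rw [← pow_sub_one_mul hq β, hβ]
  field_simp

theorem ne_zero_of_pow_sub_one_eq {q : ℕ} (hq : 2 ≤ q) (ha : a ≠ 0) (hx₀ : x₀ ≠ 0)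
    (hβ : β ^ (q - 1) = x₀ ^ 2 / a) : β ≠ 0 := by
  rintro rfl
  rw [zero_pow (by omega), eq_comm, div_eq_zero_iff] at hβ
  simp [ha, hx₀] at hβ

theorem zeros_eq [IsAlgClosed F] (hk : k ≠ 0) (ha : a ≠ 0) (hx₀ : x₀ ≠ 0)
    (hx₀n : x₀ ^ p ^ n = x₀) (h₀ : x₀ ^ (p ^ k + 1) + x₀ + a = 0)
    (hβn : β ^ p ^ n = β) (hβ : β ^ (p ^ k - 1) = x₀ ^ 2 / a)
    (hw₀n : w₀ ^ p ^ n = w₀) (hw₀ : w₀ ^ p ^ k - w₀ + 1 / (β * x₀) = 0) :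
    {x : F | x ^ p ^ n = x ∧ x ^ (p ^ k + 1) + x + a = 0} =
      insert x₀ ((fun α => (w₀ + α) ^ (p ^ k - 1) * x₀) '' {α : F | α ^ p ^ n.gcd k = α}) := by
  have hq : 2 ≤ p ^ k := Nat.one_lt_pow hk (Fact.out : p.Prime).one_lt
  have hq0 : p ^ k ≠ 0 := by omega
  have hβ0 : β ≠ 0 := ne_zero_of_pow_sub_one_eq hq ha hx₀ hβ
  have hβ' := mul_pow_eq_of_pow_sub_one_eq hq0 ha hβ
  have hc : 1 / (β * x₀) ≠ 0 := one_div_ne_zero (mul_ne_zero hβ0 hx₀)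
  have hcn : 1 / (β * x₀) ∈ frobeniusFixed F p n :=
    Subfield.div_mem _ (Subfield.one_mem _) (Subfield.mul_mem _ hβn hx₀n)
  have h₀' : x₀ * x₀ ^ p ^ k + x₀ + a = 0 := by rw [← h₀, pow_succ']
  ext x
  constructor
  · rintro ⟨hxn, hx⟩
    have hx0 : x ≠ 0 := by
      rintro rfl
      exact ha (by simpa using hx)
    obtain ⟨w, hw⟩ := IsAlgClosed.exists_pow_nat_eq (x / x₀) (by omega : 0 < p ^ k - 1)
    have hwx : w ^ (p ^ k - 1) * x₀ = x := by rw [hw, div_mul_cancel₀ _ hx₀]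
    have hw0 : w ≠ 0 := by
      rintro rfl
      rw [zero_pow (by omega), zero_mul] at hwx
      exact hx0 hwx.symm
    have hwx' : w * x = w ^ p ^ k * x₀ := by
      rw [← hwx, ← pow_sub_one_mul hq0 w]
      ring
    have hx' : x * x ^ p ^ k + x + a = 0 := by rw [← hx, pow_succ']
    rcases exists_affine_of_zero (σ := iterateFrobenius F p k) ha hx₀ h₀' hx' hwx' hβ0 hβ' hw₀
      with h | ⟨γ, α, hγ0, hγ, hα, hwγ⟩
    · left
      rw [iterateFrobenius_def] at h
      rw [h] at hwx'
      exact mul_left_cancel₀ hw0 hwx'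
    · right
      rw [iterateFrobenius_def] at hγ hα
      have hγ1 : γ ^ (p ^ k - 1) = 1 :=
        mul_right_cancel₀ hγ0 (by rw [pow_sub_one_mul hq0, hγ, one_mul])
      have hxα : (w₀ + α) ^ (p ^ k - 1) * x₀ = x := by
        rw [← hwx, hwγ, mul_pow, hγ1, one_mul]
      have hmem : (w₀ + α) ^ (p ^ k - 1) ∈ frobeniusFixed F p n := by
        rw [eq_div_of_mul_eq hx₀ hxα]
        exact Subfield.div_mem _ hxn hx₀n
      have hwmem : w₀ + α ∈ frobeniusFixed F p n := by
        rw [eq_div_of_affine hq0 hc (affine_add hw₀ hα)]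
        exact Subfield.div_mem _ (Subfield.neg_mem _ hcn)
          (Subfield.sub_mem _ hmem (Subfield.one_mem _))
      refine ⟨α, mem_frobeniusFixed_gcd ?_ hα, hxα⟩
      rw [← add_sub_cancel_left w₀ α]
      exact Subfield.sub_mem _ hwmem hw₀n
  · rintro (rfl | ⟨α, hα, rfl⟩)
    · exact ⟨hx₀n, h₀⟩
    · have hαn := frobeniusFixed_mono (Nat.gcd_dvd_left n k) hα
      have hαk : α ^ p ^ k = α := frobeniusFixed_mono (Nat.gcd_dvd_right n k) hα
      refine ⟨Subfield.mul_mem (frobeniusFixed F p n)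
        (Subfield.pow_mem _ (Subfield.add_mem _ hw₀n hαn) _) hx₀n, ?_⟩
      have hw := affine_add hw₀ hαk
      have hwne := pow_ne_one_of_affine hq0 hc hw
      set w := w₀ + α with hwdef
      have hw0 : w ≠ 0 := by
        rintro h
        rw [h, zero_pow hq0] at hw
        exact hc (by simpa using hw)
      have hx₀q : x₀ ^ p ^ k ≠ 0 := pow_ne_zero _ hx₀
      have hβq : β ^ p ^ k ≠ 0 := pow_ne_zero _ hβ0
      have hσw : w ^ p ^ k = w - 1 / (β * x₀) := by linear_combination hw
      have hσσw : (w ^ p ^ k) ^ p ^ k = w ^ p ^ k - 1 / (β ^ p ^ k * x₀ ^ p ^ k) := by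
        conv_lhs => rw [hσw, sub_pow_char_pow, div_pow, mul_pow, one_pow]
      have hdiff : x₀ * x₀ ^ p ^ k * ((w ^ p ^ k) ^ p ^ k - w ^ p ^ k) = a * (w ^ p ^ k - w) := by
        rw [hσσw, hσw]
        field_simp
        linear_combination hβ'
      set x := w ^ (p ^ k - 1) * x₀ with hxdef
      have hwx : w * x = w ^ p ^ k * x₀ := by
        rw [← pow_sub_one_mul hq0 w]
        ring
      have hwxq : w ^ p ^ k * x ^ p ^ k = (w ^ p ^ k) ^ p ^ k * x₀ ^ p ^ k := by
        rw [← mul_pow, hwx, mul_pow]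
      refine mul_left_cancel₀ hw0 ?_
      rw [pow_succ']
      linear_combination (x ^ p ^ k + 1) * hwx + x₀ * hwxq + hdiff + w ^ p ^ k * h₀'

theorem ncard_zeros [IsAlgClosed F] (hk : k ≠ 0) (ha : a ≠ 0) (hx₀ : x₀ ≠ 0)
    (hx₀n : x₀ ^ p ^ n = x₀) (h₀ : x₀ ^ (p ^ k + 1) + x₀ + a = 0)
    (hβn : β ^ p ^ n = β) (hβ : β ^ (p ^ k - 1) = x₀ ^ 2 / a)
    (hw₀n : w₀ ^ p ^ n = w₀) (hw₀ : w₀ ^ p ^ k - w₀ + 1 / (β * x₀) = 0) :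
    {x : F | x ^ p ^ n = x ∧ x ^ (p ^ k + 1) + x + a = 0}.ncard = p ^ n.gcd k + 1 := by
  have hq : 2 ≤ p ^ k := Nat.one_lt_pow hk (Fact.out : p.Prime).one_lt
  have hq0 : p ^ k ≠ 0 := by omega
  have hβ0 : β ≠ 0 := ne_zero_of_pow_sub_one_eq hq ha hx₀ hβ
  have hc : 1 / (β * x₀) ≠ 0 := one_div_ne_zero (mul_ne_zero hβ0 hx₀)
  have hcard := ncard_pow_eq_self (F := F) (p := p) (Nat.gcd_ne_zero_right (m := n) hk)
  have haff : ∀ α : F, α ^ p ^ n.gcd k = α →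
      (w₀ + α) ^ p ^ k - (w₀ + α) + 1 / (β * x₀) = 0 := fun α hα =>
    affine_add hw₀ (frobeniusFixed_mono (Nat.gcd_dvd_right n k) hα)
  have hfin : {α : F | α ^ p ^ n.gcd k = α}.Finite := Set.finite_of_ncard_ne_zero (by
    rw [hcard]
    exact pow_ne_zero _ (Fact.out : p.Prime).ne_zero)
  rw [zeros_eq hk ha hx₀ hx₀n h₀ hβn hβ hw₀n hw₀,
    Set.ncard_insert_of_notMem _ (hfin.image _), Set.InjOn.ncard_image, hcard]
  · intro α hα α' hα' h
    have hpow := mul_right_cancel₀ hx₀ h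
    have h1 := eq_div_of_affine hq0 hc (haff α hα)
    rw [hpow, ← eq_div_of_affine hq0 hc (haff α' hα')] at h1
    exact add_left_cancel h1
  · rintro ⟨α, hα, h⟩
    exact pow_ne_one_of_affine hq0 hc (haff α hα) (mul_right_cancel₀ hx₀ (h.trans (one_mul _).symm))

end Zeros

/-- Geometric sums of a power of Frobenius produce eigenvectors of that power. -/
theorem pow_geom_sum_eq_mul {F : Type*} [Field F] {p : ℕ} [ExpChar F p] {K e : ℕ} {B w : F}
    (hB : B ^ p ^ K = B) (hBe : B ^ e = 1) (hw : w ^ (p ^ K) ^ e = w) :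
    (∑ i ∈ Finset.range e, B ^ (e - 1 - i) * w ^ (p ^ K) ^ i) ^ p ^ K =
      B * ∑ i ∈ Finset.range e, B ^ (e - 1 - i) * w ^ (p ^ K) ^ i := by
  have h1 : (∑ i ∈ Finset.range e, B ^ (e - 1 - i) * w ^ (p ^ K) ^ i) ^ p ^ K =
      ∑ i ∈ Finset.range e, B ^ (e - (i + 1)) * w ^ (p ^ K) ^ (i + 1) := by
    rw [← iterateFrobenius_def, map_sum]
    refine Finset.sum_congr rfl fun i _ => ?_
    rw [iterateFrobenius_def, mul_pow, ← pow_mul w, ← pow_succ, pow_right_comm, hB,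
      Nat.sub_sub, add_comm 1 i]
  have h2 : B * ∑ i ∈ Finset.range e, B ^ (e - 1 - i) * w ^ (p ^ K) ^ i =
      ∑ i ∈ Finset.range e, B ^ (e - i) * w ^ (p ^ K) ^ i := by
    rw [Finset.mul_sum]
    refine Finset.sum_congr rfl fun i hi => ?_
    have := Finset.mem_range.1 hi
    rw [← mul_assoc, ← pow_succ', show e - 1 - i + 1 = e - i by omega]
  rw [h1, h2, ← sub_eq_zero, ← Finset.sum_sub_distrib,
    Finset.sum_range_sub (fun i => B ^ (e - i) * w ^ (p ^ K) ^ i)]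
  simp [hBe, hw]

theorem exists_affine_solution {F : Type*} [Field F] [IsAlgClosed F] {q : ℕ} (hq : 1 < q) (c : F) :
    ∃ w : F, w ^ q - w + c = 0 := by
  have hdeg : (X ^ q - X + C c : F[X]).natDegree = q := by
    rw [natDegree_add_C, FiniteField.X_pow_card_sub_X_natDegree_eq F hq]
  obtain ⟨w, hw⟩ := IsAlgClosed.exists_root (X ^ q - X + C c : F[X]) fun h => by
    have h0 := natDegree_eq_zero_iff_degree_le_zero.2 h.le
    omega
  exact ⟨w, by simpa using hw⟩

theorem stmt_19 (p k n : ℕ) [Fact p.Prime] (hk : 1 ≤ k) (hn : 1 ≤ n)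
    (d m q Q N : ℕ) (hd : d = Nat.gcd n k) (hm : m = n / d)
    (hq : q = p ^ k) (hQ : Q = p ^ n) (hN : N = m * (p ^ d - 1))
    (s : ℕ) (hs : s * ((Q - 1) * (q - 1)) = (q ^ m - 1) * (p ^ d - 1))
    (A : ℕ → Polynomial (ZMod p)) (hA1 : A 1 = 1) (hA2 : A 2 = -1)
    (hA : ∀ r : ℕ, 1 ≤ r → A (r + 2) = -(A (r + 1)) ^ q - X ^ q * A r ^ q ^ 2)
    (a : AlgebraicClosure (ZMod p)) (haQ : a ^ Q = a) (ha0 : a ≠ 0)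
    (B : ℕ → AlgebraicClosure (ZMod p)) (hB1 : B 1 = 0)
    (hB : ∀ r : ℕ, 1 ≤ r → B (r + 1) = -a * (aeval a (A r)) ^ q)
    (hma : aeval a (A m) = 0)
    (g1 g2 : AlgebraicClosure (ZMod p) → AlgebraicClosure (ZMod p))
    (hg1 : ∀ x, g1 x = ∑ i ∈ Finset.Icc 1 (m - 1),
        (aeval a (A (m - i))) ^ q ^ i * x ^ q ^ (i - 1))
    (hg2 : ∀ x, g2 x = ∑ i ∈ Finset.range (p ^ d - 1),
        B m ^ (p ^ d - 2 - i) * x ^ q ^ (m * i))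
    (S : Set (AlgebraicClosure (ZMod p)))
    (hS : S = {z : AlgebraicClosure (ZMod p) |
      ∃ y l u : AlgebraicClosure (ZMod p),
        (∃ w : AlgebraicClosure (ZMod p), w ^ q ^ N = w ∧ y = g2 w) ∧
        l ^ q = l ∧ l ≠ 0 ∧ u ^ Q = u ∧ u ≠ 0 ∧
        z = (g1 (y ^ s * l * u)) ^ (q - 1)}) :
    ((∀ z ∈ S, z ^ Q = z) ∧ (∃ z ∈ S, z ≠ 0) ∧
      (∀ x0 ∈ S, x0 ≠ 0 → x0 ^ (q + 1) + x0 + a = 0)) ∧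
    ∀ x0 ∈ S, x0 ≠ 0 →
      ((∃ c : AlgebraicClosure (ZMod p), c ^ Q = c ∧ c ^ (q - 1) = x0 ^ 2 / a) ∧
       ∀ β : AlgebraicClosure (ZMod p), β ^ Q = β → β ^ (q - 1) = x0 ^ 2 / a →
         ({w : AlgebraicClosure (ZMod p) |
             w ^ Q = w ∧ w ^ q - w + 1 / (β * x0) = 0}.ncard = p ^ d ∧
          ∀ w0 : AlgebraicClosure (ZMod p), w0 ^ Q = w0 →
            w0 ^ q - w0 + 1 / (β * x0) = 0 →
            ({x : AlgebraicClosure (ZMod p) | x ^ Q = x ∧ x ^ (q + 1) + x + a = 0} =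
               insert x0 {x : AlgebraicClosure (ZMod p) |
                 ∃ α : AlgebraicClosure (ZMod p), α ^ p ^ d = α ∧
                   x = (w0 + α) ^ (q - 1) * x0} ∧
             {x : AlgebraicClosure (ZMod p) |
               x ^ Q = x ∧ x ^ (q + 1) + x + a = 0}.ncard = p ^ d + 1))) := by
  have hp : p.Prime := Fact.out
  have hk0 : k ≠ 0 := by omega
  have hn0 : n ≠ 0 := by omega
  obtain ⟨m', k', hcop, hnm, hkk⟩ := Nat.exists_coprime n k
  rw [← hd] at hnm hkk
  have hd0 : d ≠ 0 := by rw [hd]; exact Nat.gcd_ne_zero_left hn0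
  obtain rfl : m' = m := by
    rw [hm]
    exact (Nat.div_eq_of_eq_mul_left (Nat.pos_of_ne_zero hd0) hnm).symm
  have hk'0 : k' ≠ 0 := by
    rintro rfl
    exact hk0 (by simpa using hkk)
  have hm0 : m' ≠ 0 := by
    rintro rfl
    exact hn0 (by simpa using hnm)
  have hq2 : 2 ≤ q := hq ▸ Nat.one_lt_pow hk0 hp.one_lt
  have hq0 : q ≠ 0 := by omega
  have he2 : 2 ≤ p ^ d := Nat.one_lt_pow hd0 hp.one_lt
  have hm2 : 2 ≤ m' := by
    by_contra h
    obtain rfl : m' = 1 := by omega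
    simp [hA1] at hma
  obtain ⟨M, rfl⟩ := Nat.exists_eq_add_of_le' hm2
  have hndvd : ∀ j, 0 < j → j < M + 2 → ¬ n ∣ k * j := by
    intro j hj hjm hdvd
    rw [hnm, hkk, mul_comm (M + 2), mul_comm k', mul_assoc] at hdvd
    have h := hcop.dvd_of_dvd_mul_left (Nat.dvd_of_mul_dvd_mul_left (Nat.pos_of_ne_zero hd0) hdvd)
    exact absurd (Nat.le_of_dvd hj h) (by omega)
  have hsmod : s ≡ 1 [MOD p ^ d - 1] := by
    refine modEq_one_of_mul_eq he2 hk'0 (by omega : M + 2 ≠ 0) hcop ?_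
    rw [← pow_mul, ← pow_mul, mul_comm d (M + 2), mul_comm d k', ← hnm, ← hkk, ← hq, ← hQ, hs]
  have hs0 : s ≠ 0 := by
    rintro rfl
    have hqm : 1 < q ^ (M + 2) := Nat.one_lt_pow hm0 hq2
    rw [zero_mul, eq_comm, mul_eq_zero] at hs
    omega
  set σ := iterateFrobenius (AlgebraicClosure (ZMod p)) p k
  set K := frobeniusFixed (AlgebraicClosure (ZMod p)) p n
  have hσ : ∀ x : AlgebraicClosure (ZMod p), σ x = x ^ q := fun x => by rw [hq]; rfl
  have hσi : ∀ (i : ℕ) (x : AlgebraicClosure (ZMod p)), σ^[i] x = x ^ q ^ i := fun i x => by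
    rw [hq]; exact iterate_iterateFrobenius k i x
  have hmemK : ∀ {x : AlgebraicClosure (ZMod p)}, x ∈ K ↔ x ^ Q = x := fun {x} => by rw [hQ]; rfl
  have hσK : ∀ x ∈ K, σ x ∈ K := fun x hx => by rw [hσ]; exact K.pow_mem hx q
  have hKm : ∀ x ∈ K, σ^[M + 2] x = x := fun x hx => by
    rw [hσi, hq, ← pow_mul]
    refine frobeniusFixed_mono ?_ hx
    rw [hnm, hkk]
    exact ⟨k', by ring⟩
  have hind : ∀ c : ℕ → AlgebraicClosure (ZMod p),
      (∀ x ∈ K, ∑ i ∈ Finset.range (M + 2), c i * σ^[i] x = 0) →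
      ∀ i < M + 2, c i = 0 := by
    intro c hc i hi
    refine coeff_eq_zero_of_sum_pow_eq_zero (p := p) (n := n) (k := k) hn0 hndvd ?_ hi
    intro x hx
    simpa only [hσi, hq] using hc x hx
  have haK : a ∈ K := hmemK.2 haQ
  -- The sequence `A r (a)`, extended by `0` at `r = 0`, where the recurrence still holds.
  let b : ℕ → AlgebraicClosure (ZMod p) := fun r => if r = 0 then 0 else aeval a (A r)
  have hb0 : b 0 = 0 := rfl
  have hbpos : ∀ r, 1 ≤ r → b r = aeval a (A r) := fun r hr => if_neg (by omega)
  have hb1 : b 1 = 1 := by rw [hbpos 1 le_rfl, hA1, map_one]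
  have hb : ∀ r, b (r + 2) = -σ (b (r + 1)) - σ a * σ (σ (b r)) := by
    intro r
    rcases Nat.eq_zero_or_pos r with rfl | hr
    · rw [hb0, hbpos 2 (by omega), hA2, hb1]
      simp
    · rw [hbpos r hr, hbpos (r + 1) (by omega), hbpos (r + 2) (by omega), hA r hr]
      simp only [map_sub, map_neg, map_mul, map_pow, aeval_X, hσ]
      rw [← pow_mul, sq]
  have hbK : ∀ r, b r ∈ K := by
    intro r
    induction r using Nat.twoStepInduction with
    | zero => exact K.zero_mem
    | one => rw [hb1]; exact K.one_mem
    | more r h1 h2 =>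
      rw [hb]
      exact K.sub_mem (K.neg_mem (hσK _ h2)) (K.mul_mem (hσK _ haK) (hσK _ (hσK _ h1)))
  have hbm : b (M + 2) = 0 := by rw [hbpos _ (by omega), hma]
  have hBm : B (M + 2) = -a * σ (b (M + 1)) := by
    rw [hB (M + 1) (by omega), hσ, hbpos (M + 1) (by omega)]
  have hBσ : σ (B (M + 2)) = B (M + 2) := by
    rw [hBm]
    exact twisted_multiplier_fixed hb0 hb1 hb hbm
  have hB0 : B (M + 2) ≠ 0 := by
    rw [hBm]
    exact twisted_multiplier_ne_zero hb1 hb ha0 hbm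
  have hBK : B (M + 2) ∈ K := by
    rw [hBm]
    exact K.mul_mem (K.neg_mem haK) (hσK _ (hbK _))
  have hBe : B (M + 2) ^ (p ^ d - 1) = 1 := by
    have h : B (M + 2) ^ p ^ d = B (M + 2) := by
      rw [hd]
      exact mem_frobeniusFixed_gcd hBK hBσ
    exact mul_right_cancel₀ hB0 (by rw [pow_sub_one_mul (by omega), h, one_mul])
  have hmult : ∀ z, σ (σ z) + σ z + a * z = 0 → σ^[M + 2] z = B (M + 2) * z := by
    intro z hz
    rw [iterate_eq_of_linearized_root hb0 hb1 hb hz (M + 1), hbm, hBm]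
    ring
  have hsum1 : ∀ x, g1 x =
      ∑ j ∈ Finset.range (M + 1), σ^[j + 1] (b (M + 1 - j)) * σ^[j] x := by
    intro x
    have hIcc : Finset.Icc 1 (M + 2 - 1) = Finset.Ico 1 (M + 2) := by
      ext i
      simp only [Finset.mem_Icc, Finset.mem_Ico]
      omega
    rw [hg1, hIcc, Finset.sum_Ico_eq_sum_range]
    refine Finset.sum_congr rfl fun j hj => ?_
    have hj' : j < M + 1 := Finset.mem_range.1 hj
    rw [hσi, hσi, hbpos _ (by omega), show M + 2 - (1 + j) = M + 1 - j by omega, add_comm 1 j,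
      Nat.add_sub_cancel]
  have hqmK : q ^ (M + 2) = p ^ (k * (M + 2)) := by rw [hq, pow_mul]
  have hsum2 : ∀ x, g2 x = ∑ i ∈ Finset.range (p ^ d - 1),
      B (M + 2) ^ (p ^ d - 1 - 1 - i) * x ^ (p ^ (k * (M + 2))) ^ i := by
    intro x
    rw [hg2]
    refine Finset.sum_congr rfl fun i _ => ?_
    rw [pow_mul, hqmK, Nat.sub_sub (p ^ d) 1 1]
  have hy : ∀ w : AlgebraicClosure (ZMod p), w ^ q ^ N = w →
      g2 w ^ q ^ (M + 2) = B (M + 2) * g2 w := by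
    intro w hw
    rw [hsum2, hqmK]
    refine pow_geom_sum_eq_mul ?_ hBe ?_
    · rw [← hqmK, ← hσi, hKm _ hBK]
    · rw [← hqmK, ← pow_mul, ← hN, hw]
  have hg2ne : ∃ w : AlgebraicClosure (ZMod p), w ^ q ^ N = w ∧ g2 w ≠ 0 := by
    by_contra! h
    have hkM : 0 < k * (M + 2) := Nat.mul_pos hk (by omega)
    have h0 := coeff_eq_zero_of_sum_pow_eq_zero (F := AlgebraicClosure (ZMod p)) (p := p) (n := k * N)
      (k := k * (M + 2)) (m := p ^ d - 1)
      (c := fun i => B (M + 2) ^ (p ^ d - 1 - 1 - i)) ?_ ?_ ?_ (i := p ^ d - 1 - 1) (by omega)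
    · simp at h0
    · rw [hN]
      exact mul_ne_zero hk0 (mul_ne_zero (by omega) (by omega))
    · intro j hj hjm hdvd
      rw [hN, ← mul_assoc] at hdvd
      exact absurd (Nat.le_of_dvd hj (Nat.dvd_of_mul_dvd_mul_left hkM hdvd)) (by omega)
    · intro x hx
      rw [← hsum2]
      refine h x ?_
      rw [hq, ← pow_mul]
      exact hx
  -- The properties of the arguments `t = y ^ s * l * u` of `g1`.
  have ht : ∀ w l u : AlgebraicClosure (ZMod p), w ^ q ^ N = w → l ^ q = l → l ≠ 0 → u ^ Q = u →
      σ^[M + 2] (g2 w ^ s * l * u) = B (M + 2) * (g2 w ^ s * l * u) ∧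
      ∃ c ∈ K, σ (g2 w ^ s * l * u) = c * (g2 w ^ s * l * u) := by
    intro w l u hw hl hl0 hu
    by_cases hy0 : g2 w = 0
    · refine ⟨?_, 1, K.one_mem, ?_⟩ <;> simp [hy0, hs0]
    have hyB := hy w hw
    have hlσ : σ^[M + 2] l = l := Function.iterate_fixed (by rw [hσ, hl]) _
    constructor
    · rw [iterate_map_mul, iterate_map_mul, hlσ, hKm u (hmemK.2 hu), hσi, ← pow_mul, mul_comm s,
        pow_mul, hyB, mul_pow, pow_eq_pow_of_modEq hsmod hBe, pow_one]
      ring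
    · have hqm0 : q ^ (M + 2) ≠ 0 := pow_ne_zero _ hq0
      have hy1 : g2 w ^ (q ^ (M + 2) - 1) = B (M + 2) :=
        mul_right_cancel₀ hy0 (by rw [pow_sub_one_mul hqm0, hyB])
      have hQ0 : Q ≠ 0 := hQ ▸ pow_ne_zero _ hp.ne_zero
      have hc : (g2 w ^ s) ^ (q - 1) ∈ K := by
        rw [hmemK, ← pow_sub_one_mul hQ0, ← pow_mul, ← pow_mul, mul_comm (q - 1), hs,
          pow_mul, hy1, hBe, one_mul]
      have huσ : σ u = u ^ (q - 1) * u := by rw [hσ, pow_sub_one_mul hq0]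
      refine ⟨(g2 w ^ s) ^ (q - 1) * u ^ (q - 1),
        K.mul_mem hc (K.pow_mem (hmemK.2 hu) _), ?_⟩
      rw [map_mul, map_mul, hσ l, hl, huσ, hσ, ← pow_sub_one_mul hq0 (g2 w ^ s)]
      ring
  -- Each element of `S` is `z ^ (q - 1)` for a zero `z` of the linearized polynomial.
  have hSprop : ∀ x ∈ S, x ∈ K ∧
      ∃ z, x = z ^ (q - 1) ∧ σ (σ z) + σ z + a * z = 0 := by
    intro x hx
    rw [hS] at hx
    obtain ⟨y, l, u, ⟨w, hw, rfl⟩, hl, hl0, hu, hu0, rfl⟩ := hx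
    obtain ⟨htB, c, hcK, htc⟩ := ht w l u hw hl hl0 hu
    set t := g2 w ^ s * l * u with htdef
    refine ⟨?_, g1 t, rfl, ?_⟩
    · by_cases ht0 : t = 0
      · have : g1 t = 0 := by rw [hsum1, ht0]; simp
        rw [this, zero_pow (by omega)]
        exact K.zero_mem
      have htK : t ^ (q - 1) ∈ K := by
        have : t ^ (q - 1) = c :=
          mul_right_cancel₀ ht0 (by rw [pow_sub_one_mul hq0, ← hσ, htc])
        rwa [this]
      have hdiv : g1 t / t ∈ K := by
        rw [hsum1, Finset.sum_div]
        refine K.sum_mem fun j _ => ?_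
        obtain ⟨e, he, h⟩ := iterate_eq_mul_of_mem hσK hcK htc j
        rw [h, ← mul_assoc, mul_div_cancel_right₀ _ ht0]
        exact K.mul_mem (iterate_mem hσK _ (hbK _)) he
      rw [← div_mul_cancel₀ (g1 t) ht0, mul_pow]
      exact K.mul_mem (K.pow_mem hdiv _) htK
    · exact linearized_root_of_sum hb0 hb1 hb (hKm a haK) hbm (by rw [htB, hBm]) (hsum1 t)
  have hSroot : ∀ x ∈ S, x ≠ 0 → x ^ (q + 1) + x + a = 0 ∧ ∃ z, z ≠ 0 ∧ σ z = x * z := by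
    intro x hx hx0
    obtain ⟨-, z, rfl, hz⟩ := hSprop x hx
    have hz0 : z ≠ 0 := by
      rintro rfl
      exact hx0 (zero_pow (by omega))
    have hσz : σ z = z ^ (q - 1) * z := by rw [hσ, pow_sub_one_mul hq0]
    refine ⟨?_, z, hz0, hσz⟩
    rw [hσz, map_mul, hσz, hσ] at hz
    refine mul_right_cancel₀ hz0 ?_
    rw [pow_succ]
    linear_combination hz
  have hSne : ∃ z ∈ S, z ≠ 0 := by
    obtain ⟨w, hw, hw0⟩ := hg2ne
    by_contra! hall
    have hzero : ∀ u ∈ K, ∑ j ∈ Finset.range (M + 2),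
        (σ^[j + 1] (b (M + 1 - j)) * σ^[j] (g2 w ^ s)) * σ^[j] u = 0 := by
      intro u hu
      have hlast : b (M + 1 - (M + 1)) = 0 := by rw [Nat.sub_self, hb0]
      rw [Finset.sum_range_succ, hlast]
      simp only [iterate_map_zero, zero_mul, add_zero, mul_assoc, ← iterate_map_mul]
      rw [← hsum1]
      by_cases hu0 : u = 0
      · rw [hu0, mul_zero, hsum1]
        simp
      have hmem : g1 (g2 w ^ s * 1 * u) ^ (q - 1) ∈ S := by
        rw [hS]
        exact ⟨g2 w, 1, u, ⟨w, hw, rfl⟩, one_pow _, one_ne_zero, hmemK.1 hu, hu0, rfl⟩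
      have h := hall _ hmem
      rw [mul_one] at h
      exact eq_zero_of_pow_eq_zero h
    have h := hind _ hzero M (by omega)
    rw [show M + 1 - M = 1 by omega, hb1, iterate_map_one, one_mul, hσi] at h
    exact pow_ne_zero _ (pow_ne_zero _ hw0) h
  refine ⟨⟨fun z hz => hmemK.1 (hSprop z hz).1, hSne, fun x hx hx0 => (hSroot x hx hx0).1⟩, ?_⟩
  intro x0 hx0S hx0
  have hx0K : x0 ∈ K := (hSprop x0 hx0S).1
  obtain ⟨hroot, z, hz0, hz⟩ := hSroot x0 hx0S hx0
  have hroot' : x0 * σ x0 + x0 + a = 0 := by rw [← hroot, hσ, pow_succ']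
  have hwfix : ∀ β w : AlgebraicClosure (ZMod p), β ^ (q - 1) = x0 ^ 2 / a →
      w ^ q - w + 1 / (β * x0) = 0 →
      σ^[M + 2] w = w := by
    intro β w hβ hw
    refine iterate_eq_self_of_affine hx0 hz0 hz hroot' hmult
      (ne_zero_of_pow_sub_one_eq hq2 ha0 hx0 hβ) ?_ (by rw [hσ]; exact hw)
    rw [hσ]
    exact mul_pow_eq_of_pow_sub_one_eq hq0 ha0 hβ
  constructor
  · obtain ⟨β, hβ⟩ := IsAlgClosed.exists_pow_nat_eq (x0 ^ 2 / a) (by omega : 0 < q - 1)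
    have hβ0 := ne_zero_of_pow_sub_one_eq hq2 ha0 hx0 hβ
    obtain ⟨w, hw⟩ := exists_affine_solution hq2 (1 / (β * x0))
    have hwm := hwfix β w hβ hw
    have hβm : σ^[M + 2] β = β := by
      have hβw : β = 1 / ((w - σ w) * x0) := by
        rw [hσ, show w - w ^ q = 1 / (β * x0) by linear_combination -hw]
        field_simp
      have hσwm : σ^[M + 2] (σ w) = σ w := by
        rw [← Function.iterate_succ_apply, Function.iterate_succ_apply', hwm]
      conv_lhs => rw [hβw]
      rw [← RingHom.coe_pow, map_div₀, map_one, map_mul, map_sub]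
      simp only [RingHom.coe_pow]
      rw [hwm, hσwm, hKm _ hx0K, ← hβw]
    obtain ⟨u, hu0, hu, huK⟩ := exists_fixed_div_mem hσK hKm (by omega) hind
      (K.div_mem (K.pow_mem hx0K 2) haK) hβ0 (x := β) (by rw [hσ, ← hβ, pow_sub_one_mul hq0]) hβm
    refine ⟨β / u, hmemK.1 huK, ?_⟩
    have hu1 : u ^ (q - 1) = 1 :=
      mul_right_cancel₀ hu0 (by rw [pow_sub_one_mul hq0, ← hσ, hu, one_mul])
    rw [div_pow, hu1, div_one, hβ]
  · intro β hβQ hβ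
    have hβK : β ∈ K := hmemK.2 hβQ
    have hcK : 1 / (β * x0) ∈ K := K.div_mem K.one_mem (K.mul_mem hβK hx0K)
    constructor
    · obtain ⟨w, hw⟩ := exists_affine_solution hq2 (1 / (β * x0))
      obtain ⟨v, hv, hvK⟩ := exists_fixed_sub_mem hσK hKm (by omega) hind (w := w)
        (by
          rw [hσ, show w ^ q - w = -(1 / (β * x0)) by linear_combination hw]
          exact K.neg_mem hcK) (hwfix β w hβ hw)
      have hw1 : (w - v) ^ q - (w - v) + 1 / (β * x0) = 0 := by
        rw [← hσ, map_sub, hv, hσ]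
        linear_combination hw
      rw [hq] at hw1 ⊢
      rw [hQ, affine_solutions_eq hvK hw1, Set.ncard_image_of_injective _ (add_right_injective _),
        ← hd, ncard_pow_eq_self hd0]
    · intro w0 hw0Q hw0
      rw [hq] at hroot hβ hw0 ⊢
      rw [hQ] at hw0Q hβQ ⊢
      refine ⟨?_, ?_⟩
      · rw [zeros_eq hk0 ha0 hx0 hx0K hroot hβQ hβ hw0Q hw0, ← hd]
        congr 1
        ext x
        exact exists_congr fun α => and_congr_right fun _ => eq_comm
      · rw [ncard_zeros hk0 ha0 hx0 hx0K hroot hβQ hβ hw0Q hw0, ← hd]
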